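/- Let k be a Poisson random variable with mean λ > 0 and let g : ℕ → ℝ be bounded. Then the map λ ↦ E[g(k)] is twice differentiable and d²/dλ² E[g(k)] = E[g(k+2) − 2g(k+1) + g(k)]. -/

import Mathlib

/-- The Poisson probability mass function with mean `lam`: `P(k = n) = e^{-lam} lam^n / n!`. -/
noncomputable def pois (lam : ℝ) (k : ℕ) : ℝ := Real.exp (-lam) * lam ^ k / (Nat.factorial k)

theorem summable_pow_div_factorial_mul_of_bounded {g : ℕ → ℝ} {C : ℝ}
    (hg : ∀ n, |g n| ≤ C) (l : ℝ) :
    Summable fun n : ℕ => l ^ n / (Nat.factorial n) * g n := by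
  refine Summable.of_norm_bounded
    ((Real.summable_pow_div_factorial |l|).mul_right C) fun n => ?_
  rw [norm_mul, norm_div, norm_pow, Real.norm_natCast, Real.norm_eq_abs, Real.norm_eq_abs]
  exact mul_le_mul_of_nonneg_left (hg n) (by positivity)

theorem succ_mul_pow_div_factorial_succ (l : ℝ) (n : ℕ) :
    ((n + 1 : ℕ) : ℝ) * l ^ (n + 1 - 1) / (Nat.factorial (n + 1)) =
      l ^ n / (Nat.factorial n) := by
  rw [Nat.factorial_succ, Nat.add_sub_cancel, Nat.cast_mul, mul_div_mul_left]
  positivity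

theorem hasDerivAt_tsum_pow_div_factorial_mul {g : ℕ → ℝ} {C : ℝ}
    (hg : ∀ n, |g n| ≤ C) (l : ℝ) :
    HasDerivAt (fun x : ℝ => ∑' n : ℕ, x ^ n / (Nat.factorial n) * g n)
      (∑' n : ℕ, l ^ n / (Nat.factorial n) * g (n + 1)) l := by
  set R : ℝ := |l| + 1 with hR
  have hlR : l ∈ Metric.ball (0 : ℝ) R := by simp [hR]
  have hu : Summable fun n : ℕ => (n * R ^ (n - 1) / (Nat.factorial n) : ℝ) * C := by
    refine Summable.mul_right C ((summable_nat_add_iff 1).1 ?_)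
    simpa only [succ_mul_pow_div_factorial_succ] using Real.summable_pow_div_factorial R
  have hbound : ∀ (n : ℕ) (x : ℝ), x ∈ Metric.ball (0 : ℝ) R →
      ‖(n * x ^ (n - 1) / (Nat.factorial n) : ℝ) * g n‖ ≤
        (n * R ^ (n - 1) / (Nat.factorial n) : ℝ) * C := by
    intro n x hx
    have hx' : |x| ≤ R := by simpa using (mem_ball_zero_iff.1 hx).le
    simp only [norm_mul, norm_div, norm_pow, Real.norm_natCast]
    simp only [Real.norm_eq_abs]
    gcongr
    exact hg n
  have hderiv := hasDerivAt_tsum_of_isPreconnected hu Metric.isOpen_ball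
    (convex_ball (0 : ℝ) R).isPreconnected
    (fun n x _ => ((hasDerivAt_pow n x).div_const _).mul_const (g n)) hbound hlR
    (summable_pow_div_factorial_mul_of_bounded hg l) hlR
  refine hderiv.congr_deriv ?_
  rw [(Summable.of_norm_bounded hu fun n => hbound n l hlR).tsum_eq_zero_add]
  simp only [succ_mul_pow_div_factorial_succ]
  simp

theorem tsum_pois_mul (l : ℝ) (g : ℕ → ℝ) :
    ∑' n : ℕ, pois l n * g n =
      Real.exp (-l) * ∑' n : ℕ, l ^ n / (Nat.factorial n) * g n := by
  rw [← tsum_mul_left]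
  exact tsum_congr fun n => by rw [pois]; ring

theorem hasDerivAt_tsum_pois_mul {g : ℕ → ℝ} {C : ℝ} (hg : ∀ n, |g n| ≤ C) (l : ℝ) :
    HasDerivAt (fun x : ℝ => ∑' n : ℕ, pois x n * g n)
      (∑' n : ℕ, pois l n * (g (n + 1) - g n)) l := by
  simp only [tsum_pois_mul]
  refine ((hasDerivAt_neg l).exp.mul (hasDerivAt_tsum_pow_div_factorial_mul hg l)).congr_deriv ?_
  simp only [mul_sub]
  rw [(summable_pow_div_factorial_mul_of_bounded (fun n => hg (n + 1)) l).tsum_sub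
    (summable_pow_div_factorial_mul_of_bounded hg l)]
  ring

/-- For a Poisson random variable `k` with mean `lam > 0` and a bounded `g : ℕ → ℝ`, the map
`lam ↦ E[g(k)] = ∑_{n≥0} e^{-lam} lam^n g(n)/n!` is twice differentiable and its second
derivative is `E[g(k+2) - 2 g(k+1) + g(k)]`. -/
theorem poisson_second_deriv (lam : ℝ) (hlam : 0 < lam) (g : ℕ → ℝ)
    (hg : ∃ C : ℝ, ∀ n : ℕ, |g n| ≤ C) :
    DifferentiableOn ℝ (fun l : ℝ => ∑' n : ℕ, pois l n * g n) (Set.Ioi (0 : ℝ)) ∧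
    HasDerivAt (fun l : ℝ => deriv (fun l' : ℝ => ∑' n : ℕ, pois l' n * g n) l)
      (∑' n : ℕ, pois lam n * (g (n + 2) - 2 * g (n + 1) + g n)) lam := by
  obtain ⟨C, hC⟩ := hg
  refine ⟨fun l _ =>
    (hasDerivAt_tsum_pois_mul hC l).differentiableAt.differentiableWithinAt, ?_⟩
  simp only [fun l => (hasDerivAt_tsum_pois_mul hC l).deriv]
  have hdiff : ∀ n, |g (n + 1) - g n| ≤ C + C := fun n =>
    (abs_sub _ _).trans (add_le_add (hC (n + 1)) (hC n))
  refine (hasDerivAt_tsum_pois_mul hdiff lam).congr_deriv ?_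
  exact tsum_congr fun n => by ring
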